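/- arXiv:1707.08297 — 3 statements merged into one kernel-verified Lean document; each statement's English description precedes it below -/
import Mathlib

section
/- Let n ≥ 1, let P be a finite bounded graded poset of rank n+1 with a finite group G acting on it by order-preserving bijections, and let t be a positive integer. Let Q be the bounded graded poset of rank n+1 obtained by adjoining a new minimum and a new maximum element to (P⁻ ∗ T_{t,n})₋ (the Rees product of P⁻ with T_{t,n}, with its minimum element removed). Then for every g ∈ G: β_Q([n])(g) = Σ_{S ∈ Stab([n−1])} β_P([n]∖S)(g) · t^{|S|}(1+t)^{n−2|S|} + Σ_{S ∈ Stab([n−2])} β_P([n−1]∖S)(g) · t^{|S|+1}(1+t)^{n−1−2|S|}. (Equivalently, β_Q([n]) is isomorphic as a virtual G-representation to the corresponding sum of the β_P's.) -/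
/-!
STATEMENT 0: Let n ≥ 1, P a finite bounded graded poset of rank n+1 with a finite group G
acting by order-preserving bijections, t a positive integer, and Q the bounded graded poset
of rank n+1 obtained by adjoining a new minimum and maximum to (P⁻ ∗ T_{t,n})₋.  Then for
every g ∈ G:
β_Q([n])(g) = Σ_{S ∈ Stab([n−1])} β_P([n]∖S)(g) t^{|S|}(1+t)^{n−2|S|}
            + Σ_{S ∈ Stab([n−2])} β_P([n−1]∖S)(g) t^{|S|+1}(1+t)^{n−1−2|S|}.
-/

noncomputable section

/-- The number of maximal chains of the subposet of `(X, r)` induced on `A`, all of whose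
elements satisfy the predicate `fix`.  A maximal chain of the subposet on `A` is a chain
`C ⊆ A` not properly contained in any other chain contained in `A`. -/
def nFixedMaxChains {X : Type} (r : X → X → Prop) (A : Set X) (fix : X → Prop) : ℕ :=
  Nat.card {C : Set X // C ⊆ A ∧ IsChain r C ∧
    (∀ C' : Set X, C' ⊆ A → IsChain r C' → C ⊆ C' → C' = C) ∧ ∀ x ∈ C, fix x}

/-- `α_P(S)(g)`: the number of maximal chains of the rank-selected subposet
`P_S = {x ∈ P : rk x ∈ S} ∪ {⊥, ⊤}` that are fixed pointwise by `g`. -/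
def alphaP (P : Type) [PartialOrder P] [BoundedOrder P]
    (G : Type) [Group G] [MulAction G P] (rk : P → ℕ) (S : Finset ℕ) (g : G) : ℕ :=
  nFixedMaxChains (· ≤ · : P → P → Prop) {x : P | rk x ∈ S ∨ x = ⊥ ∨ x = ⊤}
    (fun x => g • x = x)

/-- `β_P(S)(g) = Σ_{T ⊆ S} (−1)^{|S∖T|} α_P(T)(g)`. -/
def betaP (P : Type) [PartialOrder P] [BoundedOrder P]
    (G : Type) [Group G] [MulAction G P] (rk : P → ℕ) (S : Finset ℕ) (g : G) : ℤ :=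
  ∑ T ∈ S.powerset, (-1 : ℤ) ^ ((S \ T).card) * (alphaP P G rk T g : ℤ)

/-- The Rees-product order relation on pairs `(p, q)` of an element of `P` and a word `q`
(an element of `T_{t,·}`, ranked by its length): `(p₁,q₁) ⪯ (p₂,q₂)` iff `p₁ ≤ p₂`, `q₁` is
a prefix of `q₂`, and `rk p₂ − rk p₁ ≥ length q₂ − length q₁` (stated additively). -/
def reesLe (P : Type) [PartialOrder P] (rk : P → ℕ) {t : ℕ}
    (a b : P × List (Fin t)) : Prop :=
  a.1 ≤ b.1 ∧ a.2 <+: b.2 ∧ rk a.1 + b.2.length ≤ rk b.1 + a.2.length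

/-- The underlying type of `(P⁻ ∗ T_{t,n})₋`: pairs `(p, q)` with `p ≠ ⊤`, `q` a word of
length ≤ n over a `t`-letter alphabet with `length q ≤ rk p`, the minimum `(⊥, [])` removed. -/
abbrev QCore (P : Type) [PartialOrder P] [BoundedOrder P] (rk : P → ℕ) (t n : ℕ) : Type :=
  {pq : P × List (Fin t) // pq.1 ≠ ⊤ ∧ pq.2.length ≤ n ∧ pq.2.length ≤ rk pq.1 ∧
    ¬(pq.1 = ⊥ ∧ pq.2 = [])}

/-- The poset `Q` obtained from `(P⁻ ∗ T_{t,n})₋` by adjoining a new minimum (`none`) and a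
new maximum (`some none`). -/
abbrev QType (P : Type) [PartialOrder P] [BoundedOrder P] (rk : P → ℕ) (t n : ℕ) : Type :=
  Option (Option (QCore P rk t n))

/-- The order relation of `Q`. -/
def QLe (P : Type) [PartialOrder P] [BoundedOrder P] (rk : P → ℕ) (t n : ℕ) :
    QType P rk t n → QType P rk t n → Prop
  | none, _ => True
  | some none, b => b = some none
  | some (some _), none => False
  | some (some _), some none => True
  | some (some c), some (some c') => reesLe P rk c.val c'.val

/-- The rank function of `Q` (a bounded graded poset of rank `n+1`). -/
def QRank (P : Type) [PartialOrder P] [BoundedOrder P] (rk : P → ℕ) (t n : ℕ) :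
    QType P rk t n → ℕ
  | none => 0
  | some none => n + 1
  | some (some c) => rk c.val.1

/-- The fixed-point predicate on `Q` for the induced `G`-action `g • (p, q) = (g • p, q)`:
the new minimum and maximum are fixed, and a core element `(p,q)` is fixed iff `g • p = p`. -/
def QFix (P : Type) [PartialOrder P] [BoundedOrder P]
    (G : Type) [Group G] [MulAction G P] (rk : P → ℕ) (t n : ℕ) (g : G) :
    QType P rk t n → Prop
  | some (some c) => g • c.val.1 = c.val.1
  | _ => True

/-- `α_Q(S)(g)` for the poset `Q`. -/
def alphaQ (P : Type) [PartialOrder P] [BoundedOrder P]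
    (G : Type) [Group G] [MulAction G P] (rk : P → ℕ) (t n : ℕ) (S : Finset ℕ) (g : G) : ℕ :=
  nFixedMaxChains (QLe P rk t n)
    {x : QType P rk t n | QRank P rk t n x ∈ S ∨ x = none ∨ x = some none}
    (QFix P G rk t n g)

/-- `β_Q(S)(g)`. -/
def betaQ (P : Type) [PartialOrder P] [BoundedOrder P]
    (G : Type) [Group G] [MulAction G P] (rk : P → ℕ) (t n : ℕ) (S : Finset ℕ) (g : G) : ℤ :=
  ∑ T ∈ S.powerset, (-1 : ℤ) ^ ((S \ T).card) * (alphaQ P G rk t n T g : ℤ)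

/-- The sequences `f` picking, for each `s ∈ S`, an element `f s` of rank `s` satisfying `fix`,
monotonically in `s`; outside `S` the value is the default `b`. -/
def rankChains {X : Type} (r : X → X → Prop) (b : X) (ρ : X → ℕ) (fix : X → Prop)
    (S : Finset ℕ) : Set (ℕ → X) :=
  {f | (∀ s ∉ S, f s = b) ∧ (∀ s ∈ S, ρ (f s) = s ∧ fix (f s)) ∧
    ∀ i ∈ S, ∀ j ∈ S, i ≤ j → r (f i) (f j)}

/-- In a bounded poset whose rank function interpolates, the maximal chains of a rank-selected
subposet meet every selected rank exactly once. -/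
lemma nFixedMaxChains_eq_card_rankChains {X : Type} (r : X → X → Prop) (b u : X) (ρ : X → ℕ)
    (N : ℕ) (hrefl : ∀ x, r x x) (htrans : ∀ x y z, r x y → r y z → r x z)
    (hb : ∀ x, r b x) (hu : ∀ x, r x u) (hρb : ρ b = 0) (hρu : ρ u = N + 1)
    (hstrict : ∀ x y, r x y → x ≠ y → ρ x < ρ y)
    (hinterp : ∀ x y s, r x y → ρ x ≤ s → s ≤ ρ y → ∃ z, ρ z = s ∧ r x z ∧ r z y)
    (fix : X → Prop) (hfb : fix b) (hfu : fix u) (S : Finset ℕ) (hS : S ⊆ Finset.Icc 1 N) :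
    nFixedMaxChains r {x | ρ x ∈ S ∨ x = b ∨ x = u} fix =
      Nat.card (rankChains r b ρ fix S) := by
  have hS' : ∀ s ∈ S, 1 ≤ s ∧ s ≤ N := fun s hs => Finset.mem_Icc.1 (hS hs)
  have hle : ∀ x y, r x y → ρ x ≤ ρ y := by
    intro x y h
    by_cases hxy : x = y
    · rw [hxy]
    · exact (hstrict x y h hxy).le
  have hcomp : ∀ C : Set X, IsChain r C → ∀ x ∈ C, ∀ y ∈ C, ρ x ≤ ρ y → r x y := by
    intro C hC x hx y hy h
    by_cases hxy : x = y
    · rw [hxy]; exact hrefl y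
    · rcases hC hx hy hxy with h' | h'
      · exact h'
      · exact absurd (hstrict _ _ h' (Ne.symm hxy)) (not_lt.2 h)
  have hrankinj : ∀ C : Set X, IsChain r C → ∀ x ∈ C, ∀ y ∈ C, ρ x = ρ y → x = y := by
    intro C hC x hx y hy h
    by_contra hxy
    exact (hstrict x y (hcomp C hC x hx y hy h.le) hxy).ne h
  let F : (ℕ → X) → Set X := fun f => {x | x = b ∨ x = u ∨ ∃ s ∈ S, f s = x}
  have hF : ∀ f : rankChains r b ρ fix S, F f ⊆ {x | ρ x ∈ S ∨ x = b ∨ x = u} ∧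
      IsChain r (F f) ∧ (∀ C' : Set X, C' ⊆ {x | ρ x ∈ S ∨ x = b ∨ x = u} → IsChain r C' →
        F f ⊆ C' → C' = F f) ∧ ∀ x ∈ F f, fix x := by
    rintro ⟨f, hf0, hf1, hf2⟩
    refine ⟨?_, ?_, ?_, ?_⟩
    · rintro x (h | h | ⟨s, hs, rfl⟩)
      · exact Or.inr (Or.inl h)
      · exact Or.inr (Or.inr h)
      · left; rw [(hf1 s hs).1]; exact hs
    · rintro x (rfl | rfl | ⟨s, hs, rfl⟩) y hy hxy
      · exact Or.inl (hb _)
      · exact Or.inr (hu _)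
      · rcases hy with rfl | rfl | ⟨s', hs', rfl⟩
        · exact Or.inr (hb _)
        · exact Or.inl (hu _)
        · rcases le_total s s' with h | h
          · exact Or.inl (hf2 _ hs _ hs' h)
          · exact Or.inr (hf2 _ hs' _ hs h)
    · intro C' hC' hch hsub
      refine Set.Subset.antisymm ?_ hsub
      intro x hx
      rcases hC' hx with h | h | h
      · right; right
        refine ⟨ρ x, h, hrankinj C' hch _ (hsub (Or.inr (Or.inr ⟨ρ x, h, rfl⟩))) _ hx ?_⟩
        exact (hf1 _ h).1
      · exact Or.inl h
      · exact Or.inr (Or.inl h)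
    · rintro x (rfl | rfl | ⟨s, hs, rfl⟩)
      · exact hfb
      · exact hfu
      · exact (hf1 s hs).2
  symm
  refine Nat.card_congr (Equiv.ofBijective (fun f => ⟨F f, hF f⟩) ⟨?_, ?_⟩)
  · intro f f' hff
    have hff' : F f = F f' := congrArg Subtype.val hff
    obtain ⟨f, hf⟩ := f
    obtain ⟨f', hf'⟩ := f'
    apply Subtype.ext
    funext s
    by_cases hs : s ∈ S
    · have h1 : f' s ∈ F f := by rw [hff']; exact Or.inr (Or.inr ⟨s, hs, rfl⟩)
      refine hrankinj _ (hF ⟨f, hf⟩).2.1 _ (Or.inr (Or.inr ⟨s, hs, rfl⟩)) _ h1 ?_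
      rw [(hf.2.1 s hs).1, (hf'.2.1 s hs).1]
    · exact (hf.1 s hs).trans (hf'.1 s hs).symm
  · rintro ⟨C, hCA, hCch, hCmax, hCfix⟩
    have hins : ∀ z, (ρ z ∈ S ∨ z = b ∨ z = u) → (∀ c ∈ C, r z c ∨ r c z) → z ∈ C := by
      intro z hz hzc
      have := hCmax (insert z C) (Set.insert_subset hz hCA)
        (hCch.insert (fun c hc _ => hzc c hc)) (Set.subset_insert z C)
      rw [← this]
      exact Set.mem_insert z C
    have hbC : b ∈ C := hins b (Or.inr (Or.inl rfl)) fun c _ => Or.inl (hb c)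
    have huC : u ∈ C := hins u (Or.inr (Or.inr rfl)) fun c _ => Or.inr (hu c)
    have hex : ∀ s ∈ S, ∃ x ∈ C, ρ x = s := by
      intro s hs
      by_contra hno
      push Not at hno
      obtain ⟨x, ⟨hxC, hxs⟩, hxmax⟩ : ∃ x, (x ∈ C ∧ ρ x < s) ∧
          ∀ y ∈ C, ρ y < s → ρ y ≤ ρ x := by
        let T : Set ℕ := {k | ∃ x ∈ C, ρ x = k ∧ k < s}
        have hTne : T.Nonempty := ⟨0, b, hbC, hρb, (hS' s hs).1⟩
        have hTb : BddAbove T := ⟨s, by rintro k ⟨x, _, _, h⟩; exact h.le⟩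
        obtain ⟨x, hx, hk, hlt⟩ := Nat.sSup_mem hTne hTb
        refine ⟨x, ⟨hx, by omega⟩, fun y hy hys => ?_⟩
        rw [hk]
        exact le_csSup hTb ⟨y, hy, rfl, hys⟩
      obtain ⟨y, ⟨hyC, hys⟩, hymin⟩ : ∃ y, (y ∈ C ∧ s < ρ y) ∧
          ∀ z ∈ C, s < ρ z → ρ y ≤ ρ z := by
        let T : Set ℕ := {k | ∃ x ∈ C, ρ x = k ∧ s < k}
        have hTne : T.Nonempty := ⟨N + 1, u, huC, hρu, by have := (hS' s hs).2; omega⟩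
        obtain ⟨x, hx, hk, hlt⟩ := Nat.sInf_mem hTne
        refine ⟨x, ⟨hx, by omega⟩, fun y hy hys => ?_⟩
        rw [hk]
        exact Nat.sInf_le ⟨y, hy, rfl, hys⟩
      obtain ⟨z, hz, hxz, hzy⟩ :=
        hinterp x y s (hcomp C hCch x hxC y hyC (by omega)) hxs.le hys.le
      refine hno z (hins z (Or.inl (by rw [hz]; exact hs)) fun c hc => ?_) hz
      rcases lt_trichotomy (ρ c) s with h | h | h
      · exact Or.inr (htrans _ _ _ (hcomp C hCch c hc x hxC (hxmax c hc h)) hxz)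
      · exact absurd h (hno c hc)
      · exact Or.inl (htrans _ _ _ hzy (hcomp C hCch y hyC c hc (hymin c hc h)))
    have hex' : ∀ s, ∃ x, (s ∈ S → x ∈ C ∧ ρ x = s) ∧ (s ∉ S → x = b) := by
      intro s
      by_cases hs : s ∈ S
      · obtain ⟨x, hx⟩ := hex s hs
        exact ⟨x, fun _ => hx, fun h => absurd hs h⟩
      · exact ⟨b, fun h => absurd h hs, fun _ => rfl⟩
    choose f hf hf' using hex'
    refine ⟨⟨f, hf', fun s hs => ⟨(hf s hs).2, hCfix _ (hf s hs).1⟩, fun i hi j hj hij =>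
      hcomp C hCch _ (hf i hi).1 _ (hf j hj).1 (by rw [(hf i hi).2, (hf j hj).2]; exact hij)⟩,
      ?_⟩
    apply Subtype.ext
    apply Set.Subset.antisymm
    · rintro x (rfl | rfl | ⟨s, hs, rfl⟩)
      · exact hbC
      · exact huC
      · exact (hf s hs).1
    · intro x hx
      rcases hCA hx with h | h | h
      · exact Or.inr (Or.inr ⟨ρ x, h, hrankinj C hCch _ (hf _ h).1 _ hx (hf _ h).2⟩)
      · exact Or.inl h
      · exact Or.inr (Or.inl h)

section Graded

variable {P : Type} [PartialOrder P] {rk : P → ℕ}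

lemma rank_lt_rank_of_lt [Finite P] (hgraded : ∀ x y : P, x ⋖ y → rk y = rk x + 1) :
    ∀ x y : P, x < y → rk x < rk y := by
  intro x
  induction x using WellFoundedGT.induction with
  | ind x ih =>
    intro y hxy
    obtain ⟨z, hxz, hzy⟩ := exists_covBy_le_of_lt hxy
    have h1 := hgraded x z hxz
    rcases hzy.eq_or_lt with rfl | h
    · omega
    · have := ih z hxz.lt y h
      omega

lemma exists_rank_eq_between [Finite P] (hgraded : ∀ x y : P, x ⋖ y → rk y = rk x + 1)
    (x y : P) (s : ℕ) (hxy : x ≤ y) (hs : rk x ≤ s) (hs' : s ≤ rk y) :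
    ∃ z, rk z = s ∧ x ≤ z ∧ z ≤ y := by
  induction s, hs using Nat.le_induction with
  | base => exact ⟨x, rfl, le_rfl, hxy⟩
  | succ s _ ih =>
    obtain ⟨z, hz, hxz, hzy⟩ := ih (by omega)
    have hlt : z < y := lt_of_le_of_ne hzy (by rintro rfl; omega)
    obtain ⟨w, hzw, hwy⟩ := exists_covBy_le_of_lt hlt
    exact ⟨w, by rw [hgraded z w hzw, hz], hxz.trans hzw.le, hwy⟩

end Graded

lemma alphaP_eq_card_rankChains {n : ℕ} {P : Type} [Finite P] [PartialOrder P] [BoundedOrder P]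
    {rk : P → ℕ} (hrk_bot : rk ⊥ = 0) (hrk_top : rk ⊤ = n + 1)
    (hgraded : ∀ x y : P, x ⋖ y → rk y = rk x + 1)
    {G : Type} [Group G] [MulAction G P]
    (hact : ∀ (g : G) (x y : P), x ≤ y → g • x ≤ g • y) (g : G)
    (S : Finset ℕ) (hS : S ⊆ Finset.Icc 1 n) :
    alphaP P G rk S g = Nat.card (rankChains (· ≤ ·) (⊥ : P) rk (fun x => g • x = x) S) := by
  refine nFixedMaxChains_eq_card_rankChains _ _ _ rk n le_refl (fun _ _ _ => le_trans)
    (fun _ => bot_le) (fun _ => le_top) hrk_bot hrk_top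
    (fun x y h h' => rank_lt_rank_of_lt hgraded x y (lt_of_le_of_ne h h'))
    (exists_rank_eq_between hgraded) _ ?_ ?_ S hS
  · refine le_bot_iff.1 ?_
    have := hact g ⊥ (g⁻¹ • ⊥) bot_le
    rwa [smul_inv_smul] at this
  · refine top_le_iff.1 ?_
    have := hact g (g⁻¹ • ⊤) ⊤ le_top
    rwa [smul_inv_smul] at this

/-- Chains of words in the `t`-ary tree indexed by `S`, whose growth between two indices
(counted from `0`, where the word is empty) is at most the difference of the indices. -/
def wordChains (t : ℕ) (S : Finset ℕ) : Set (ℕ → List (Fin t)) :=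
  {w | (∀ s ∉ S, w s = []) ∧ ∀ i ∈ insert 0 S, ∀ j ∈ insert 0 S, i ≤ j →
    w i <+: w j ∧ (w j).length + i ≤ (w i).length + j}

section ReesProduct

variable {P : Type} [PartialOrder P] [BoundedOrder P] {rk : P → ℕ} {t n : ℕ}

lemma QLe_refl (x : QType P rk t n) : QLe P rk t n x x := by
  rcases x with _ | _ | c
  · trivial
  · exact rfl
  · exact ⟨le_rfl, List.prefix_rfl, le_rfl⟩

lemma QLe_trans (x y z : QType P rk t n) (hxy : QLe P rk t n x y) (hyz : QLe P rk t n y z) :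
    QLe P rk t n x z := by
  rcases x with _ | _ | x <;> rcases y with _ | _ | y <;> rcases z with _ | _ | z <;>
    first
    | trivial
    | (simp [QLe] at hxy hyz; done)
    | skip
  obtain ⟨h1, h2, h3⟩ := hxy
  obtain ⟨h4, h5, h6⟩ := hyz
  exact ⟨h1.trans h4, h2.trans h5, by omega⟩

lemma QRank_lt_of_QLe [Finite P] (hrk_bot : rk ⊥ = 0) (hrk_top : rk ⊤ = n + 1)
    (hgraded : ∀ x y : P, x ⋖ y → rk y = rk x + 1) (x y : QType P rk t n)
    (hxy : QLe P rk t n x y) (hne : x ≠ y) : QRank P rk t n x < QRank P rk t n y := by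
  have hlt := rank_lt_rank_of_lt hgraded
  rcases x with _ | _ | ⟨⟨p, q⟩, hp, hqn, hqp, hpq⟩ <;>
    rcases y with _ | _ | ⟨⟨p', q'⟩, hp', hqn', hqp', hpq'⟩
  · exact absurd rfl hne
  · exact Nat.succ_pos n
  · change 0 < rk p'
    rcases eq_or_ne p' ⊥ with rfl | h
    · simp only [hrk_bot, Nat.le_zero, List.length_eq_zero_iff] at hqp'
      exact absurd ⟨rfl, hqp'⟩ hpq'
    · have := hlt ⊥ p' (bot_lt_iff_ne_bot.2 h)
      omega
  · simp [QLe] at hxy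
  · exact absurd rfl hne
  · simp [QLe] at hxy
  · exact absurd hxy id
  · change rk p < n + 1
    rw [← hrk_top]
    exact hlt p ⊤ (lt_top_iff_ne_top.2 hp)
  · obtain ⟨h1, h2, h3⟩ := hxy
    change rk p < rk p'
    rcases h1.eq_or_lt with h | h
    · exfalso
      simp only at h h2 h3
      subst h
      have : q = q' := h2.eq_of_length_le (by omega)
      subst this
      exact hne rfl
    · exact hlt p p' h

lemma exists_QRank_eq_between [Finite P] (hrk_bot : rk ⊥ = 0) (hrk_top : rk ⊤ = n + 1)
    (hgraded : ∀ x y : P, x ⋖ y → rk y = rk x + 1) (x y : QType P rk t n) (s : ℕ)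
    (hxy : QLe P rk t n x y) (hs : QRank P rk t n x ≤ s) (hs' : s ≤ QRank P rk t n y) :
    ∃ z, QRank P rk t n z = s ∧ QLe P rk t n x z ∧ QLe P rk t n z y := by
  have hlt := rank_lt_rank_of_lt hgraded
  have hbtw := exists_rank_eq_between hgraded
  rcases x with _ | _ | ⟨⟨p, q⟩, hp, hqn, hqp, hpq⟩ <;>
    rcases y with _ | _ | ⟨⟨p', q'⟩, hp', hqn', hqp', hpq'⟩
  · exact ⟨none, (Nat.le_zero.1 hs').symm, trivial, trivial⟩
  · rcases Nat.eq_zero_or_pos s with rfl | hs0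
    · exact ⟨none, rfl, trivial, trivial⟩
    rcases (show s ≤ n + 1 from hs').eq_or_lt with rfl | hsn
    · exact ⟨some none, rfl, trivial, rfl⟩
    obtain ⟨z, hz, -, -⟩ := hbtw ⊥ ⊤ s bot_le (by omega) (by omega)
    refine ⟨some (some ⟨(z, []), ?_, ?_, ?_, ?_⟩), hz, trivial, trivial⟩
    · rintro rfl; omega
    · simp
    · simp
    · rintro ⟨rfl, -⟩; omega
  · rcases Nat.eq_zero_or_pos s with rfl | hs0
    · exact ⟨none, rfl, trivial, trivial⟩
    replace hs' : s ≤ rk p' := hs'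
    simp only at hp' hqn' hqp'
    obtain ⟨z, hz, -, hzy⟩ := hbtw ⊥ p' s bot_le (by omega) hs'
    refine ⟨some (some ⟨(z, q'.take s), ?_, ?_, ?_, ?_⟩), hz, trivial, hzy,
      List.take_prefix _ _, ?_⟩
    · rintro rfl; exact hp' (top_le_iff.1 hzy)
    · simp; omega
    · simp; omega
    · rintro ⟨rfl, -⟩; omega
    · simp; omega
  · simp [QLe] at hxy
  · exact ⟨some none, le_antisymm hs hs', rfl, rfl⟩
  · simp [QLe] at hxy
  · exact absurd hxy id
  · rcases (show s ≤ n + 1 from hs').eq_or_lt with rfl | hsn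
    · exact ⟨some none, rfl, trivial, rfl⟩
    replace hs : rk p ≤ s := hs
    simp only at hp hqn hqp hpq
    obtain ⟨z, hz, hpz, -⟩ := hbtw p ⊤ s le_top hs (by omega)
    refine ⟨some (some ⟨(z, q), ?_, ?_, ?_, ?_⟩), hz, ⟨hpz, List.prefix_rfl, ?_⟩, trivial⟩
    · rintro rfl; omega
    · exact hqn
    · simp only; omega
    · rintro ⟨rfl, hq⟩
      exact hpq ⟨le_bot_iff.1 hpz, hq⟩
    · simp only; omega
  · obtain ⟨h1, h2, h3⟩ := hxy
    replace hs : rk p ≤ s := hs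
    replace hs' : s ≤ rk p' := hs'
    simp only at h1 h2 h3 hp hqn hqp hpq hp' hqn' hqp' hpq'
    obtain ⟨z, hz, hpz, hzp⟩ := hbtw p p' s h1 hs hs'
    have hpre : q <+: q'.take (q.length + (s - rk p)) := by
      rw [List.prefix_take_iff]
      exact ⟨h2, by omega⟩
    refine ⟨some (some ⟨(z, q'.take (q.length + (s - rk p))), ?_, ?_, ?_, ?_⟩), hz,
      ⟨hpz, hpre, ?_⟩, ⟨hzp, List.take_prefix _ _, ?_⟩⟩
    · rintro rfl; exact hp' (top_le_iff.1 hzp)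
    · simp; omega
    · simp; omega
    · rintro ⟨rfl, hq⟩
      simp only at hq
      rw [hq] at hpre
      exact hpq ⟨le_bot_iff.1 hpz, List.prefix_nil.1 hpre⟩
    · simp; omega
    · simp; omega

/-- The first component of an element of `Q`. -/
def QFst : QType P rk t n → P
  | some (some c) => c.val.1
  | _ => ⊥

/-- The second component of an element of `Q`. -/
def QSnd : QType P rk t n → List (Fin t)
  | some (some c) => c.val.2
  | _ => []

lemma exists_core_of_QRank {x : QType P rk t n} (h1 : 1 ≤ QRank P rk t n x)
    (hn : QRank P rk t n x ≤ n) : ∃ c : QCore P rk t n, x = some (some c) := by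
  rcases x with _ | _ | c
  · exact absurd h1 (by simp [QRank])
  · exact absurd hn (by simp [QRank])
  · exact ⟨c, rfl⟩

lemma alphaQ_eq_alphaP_mul_card_wordChains [Finite P] (hrk_bot : rk ⊥ = 0)
    (hrk_top : rk ⊤ = n + 1) (hgraded : ∀ x y : P, x ⋖ y → rk y = rk x + 1)
    {G : Type} [Group G] [MulAction G P]
    (hact : ∀ (g : G) (x y : P), x ≤ y → g • x ≤ g • y) (g : G)
    (S : Finset ℕ) (hS : S ⊆ Finset.Icc 1 n) :
    alphaQ P G rk t n S g = alphaP P G rk S g * Nat.card (wordChains t S) := by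
  have hS' : ∀ s ∈ S, 1 ≤ s ∧ s ≤ n := fun s hs => Finset.mem_Icc.1 (hS hs)
  have h0 : 0 ∉ S := fun h => by have := (hS' 0 h).1; omega
  rw [alphaP_eq_card_rankChains hrk_bot hrk_top hgraded hact g S hS, ← Nat.card_prod]
  refine (nFixedMaxChains_eq_card_rankChains (QLe P rk t n) none (some none) (QRank P rk t n) n
    QLe_refl QLe_trans (fun _ => trivial) ?_ rfl rfl
    (QRank_lt_of_QLe hrk_bot hrk_top hgraded) (exists_QRank_eq_between hrk_bot hrk_top hgraded)
    (QFix P G rk t n g) trivial trivial S hS).trans ?_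
  · rintro (_ | _ | c)
    · trivial
    · exact rfl
    · trivial
  have hcore : ∀ f ∈ rankChains (QLe P rk t n) none (QRank P rk t n) (QFix P G rk t n g) S,
      ∀ s ∈ S, ∃ c : QCore P rk t n, f s = some (some c) := by
    intro f hf s hs
    have h := (hf.2.1 s hs).1
    exact exists_core_of_QRank (by rw [h]; exact (hS' s hs).1) (by rw [h]; exact (hS' s hs).2)
  refine Nat.card_congr (Equiv.ofBijective
    (fun f => (⟨fun s => QFst (f.1 s), ?_⟩, ⟨fun s => QSnd (f.1 s), ?_⟩)) ⟨?_, ?_⟩)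
  · obtain ⟨f, hf⟩ := f
    refine ⟨fun s hs => by simp only [hf.1 s hs]; rfl, fun s hs => ?_, fun i hi j hj hij => ?_⟩
    · obtain ⟨c, hc⟩ := hcore f hf s hs
      have := hf.2.1 s hs
      simp only [hc] at this ⊢
      exact this
    · obtain ⟨c, hc⟩ := hcore f hf i hi
      obtain ⟨d, hd⟩ := hcore f hf j hj
      have := hf.2.2 i hi j hj hij
      simp only [hc, hd] at this ⊢
      exact this.1
  · obtain ⟨f, hf⟩ := f
    have hnil : ∀ s ∉ S, QSnd (f s) = [] := fun s hs => by simp only [hf.1 s hs]; rfl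
    refine ⟨hnil, fun i hi j hj hij => ?_⟩
    simp only
    rcases Finset.mem_insert.1 hi with rfl | hi
    · rw [hnil 0 h0]
      refine ⟨List.nil_prefix, ?_⟩
      rcases Finset.mem_insert.1 hj with rfl | hj
      · simp [hnil 0 h0]
      · obtain ⟨d, hd⟩ := hcore f hf j hj
        have := (hf.2.1 j hj).1
        rw [hd] at this ⊢
        change rk d.val.1 = j at this
        change d.val.2.length + 0 ≤ 0 + j
        have := d.2.2.2.1
        omega
    · rcases Finset.mem_insert.1 hj with rfl | hj
      · have := (hS' i hi).1
        omega
      · obtain ⟨c, hc⟩ := hcore f hf i hi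
        obtain ⟨d, hd⟩ := hcore f hf j hj
        have h1 := hf.2.2 i hi j hj hij
        have h2 := (hf.2.1 i hi).1
        have h3 := (hf.2.1 j hj).1
        rw [hc] at h1 h2 ⊢
        rw [hd] at h1 h3 ⊢
        change rk c.val.1 = i at h2
        change rk d.val.1 = j at h3
        obtain ⟨h4, h5, h6⟩ := h1
        refine ⟨h5, ?_⟩
        change d.val.2.length + i ≤ c.val.2.length + j
        omega
  · rintro ⟨f, hf⟩ ⟨f', hf'⟩ h
    simp only [Prod.mk.injEq, Subtype.mk.injEq] at h
    apply Subtype.ext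
    funext s
    by_cases hs : s ∈ S
    · obtain ⟨c, hc⟩ := hcore f hf s hs
      obtain ⟨d, hd⟩ := hcore f' hf' s hs
      have h1 := congrFun h.1 s
      have h2 := congrFun h.2 s
      simp only [hc, hd] at h1 h2 ⊢
      congr 2
      exact Subtype.ext (Prod.ext h1 h2)
    · exact (hf.1 s hs).trans (hf'.1 s hs).symm
  · rintro ⟨⟨p, hp⟩, ⟨w, hw⟩⟩
    have hex : ∀ s, ∃ x : QType P rk t n, (s ∈ S → ∃ c : QCore P rk t n,
        x = some (some c) ∧ c.val = (p s, w s)) ∧ (s ∉ S → x = none) := by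
      intro s
      by_cases hs : s ∈ S
      · have hps := (hp.2.1 s hs).1
        have hws := (hw.2 0 (by simp) s (by simp [hs]) (Nat.zero_le s)).2
        have := hS' s hs
        rw [hw.1 0 h0] at hws
        simp only [List.length_nil] at hws
        refine ⟨some (some ⟨(p s, w s), ?_, ?_, ?_, ?_⟩), fun _ => ⟨_, rfl, rfl⟩,
          fun h => absurd hs h⟩
        · intro h
          simp only at h
          rw [h] at hps
          omega
        · simp only; omega
        · simp only; omega
        · rintro ⟨h, -⟩
          simp only at h
          rw [h] at hps
          omega
      · exact ⟨none, fun h => absurd h hs, fun _ => rfl⟩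
    choose f hf hf' using hex
    refine ⟨⟨f, hf', fun s hs => ?_, fun i hi j hj hij => ?_⟩, ?_⟩
    · obtain ⟨c, hc, hc'⟩ := hf s hs
      have := hp.2.1 s hs
      rw [hc]
      simp only [QRank, QFix, hc']
      exact this
    · obtain ⟨c, hc, hc'⟩ := hf i hi
      obtain ⟨d, hd, hd'⟩ := hf j hj
      have h1 := hw.2 i (by simp [hi]) j (by simp [hj]) hij
      rw [hc, hd]
      simp only [QLe, reesLe, hc', hd', (hp.2.1 i hi).1, (hp.2.1 j hj).1]
      exact ⟨hp.2.2 i hi j hj hij, h1.1, by omega⟩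
    · have key : ∀ s, QFst (f s) = p s ∧ QSnd (f s) = w s := by
        intro s
        by_cases hs : s ∈ S
        · obtain ⟨c, hc, hc'⟩ := hf s hs
          rw [hc]
          simp only [QFst, QSnd, hc', and_self]
        · rw [hf' s hs, hp.1 s hs, hw.1 s hs]
          exact ⟨rfl, rfl⟩
      refine Prod.ext (Subtype.ext (funext fun s => (key s).1))
        (Subtype.ext (funext fun s => (key s).2))

end ReesProduct

/-- The number of words of length at most `d` over a `t`-letter alphabet. -/
def numWords (t d : ℕ) : ℕ := Nat.card {u : List (Fin t) // u.length ≤ d}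

lemma numWords_zero (t : ℕ) : numWords t 0 = 1 := by
  rw [numWords, Nat.card_eq_one_iff_unique]
  refine ⟨⟨fun ⟨u, hu⟩ ⟨v, hv⟩ => ?_⟩, ⟨⟨[], by simp⟩⟩⟩
  simp only [Nat.le_zero, List.length_eq_zero_iff] at hu hv
  simp [hu, hv]

lemma numWords_succ (t d : ℕ) : numWords t (d + 1) = 1 + t * numWords t d := by
  have e : {u : List (Fin t) // u.length ≤ d + 1} ≃
      Option (Fin t × {u : List (Fin t) // u.length ≤ d}) :=
    { toFun := fun
        | ⟨[], _⟩ => none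
        | ⟨a :: u, h⟩ => some (a, ⟨u, by simpa using h⟩)
      invFun := fun
        | none => ⟨[], by simp⟩
        | some (a, u) => ⟨a :: u.1, by simpa using u.2⟩
      left_inv := by rintro ⟨_ | ⟨a, u⟩, h⟩ <;> rfl
      right_inv := by rintro (_ | ⟨a, u, h⟩) <;> rfl }
  have : Finite {u : List (Fin t) // u.length ≤ d} := List.finite_length_le (Fin t) d
  rw [numWords, Nat.card_congr e, Finite.card_option, Nat.card_prod, Nat.card_fin, add_comm,
    numWords]

lemma card_wordChains_empty (t : ℕ) : Nat.card (wordChains t ∅) = 1 := by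
  rw [Nat.card_eq_one_iff_unique]
  refine ⟨⟨fun ⟨u, hu⟩ ⟨v, hv⟩ => ?_⟩, ⟨⟨fun _ => [], by simp [wordChains]⟩⟩⟩
  apply Subtype.ext
  funext s
  exact (hu.1 s (by simp)).trans (hv.1 s (by simp)).symm

lemma card_wordChains_insert (t : ℕ) {S : Finset ℕ} {m : ℕ} (hm : 0 < m) (h0 : 0 ∉ S)
    (hS : ∀ s ∈ S, s < m) :
    Nat.card (wordChains t (insert m S)) =
      Nat.card (wordChains t S) * numWords t (m - S.sup id) := by
  obtain ⟨l, hl⟩ : ∃ l, l = S.sup id := ⟨_, rfl⟩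
  have hlS : l ∈ insert 0 S := by
    rcases S.eq_empty_or_nonempty with rfl | hne
    · simp [hl]
    · obtain ⟨i, hi, hi'⟩ := Finset.exists_mem_eq_sup S hne id
      rw [hl, hi']
      exact Finset.mem_insert_of_mem hi
  have hSl : ∀ i ∈ insert 0 S, i ≤ l := by
    intro i hi
    rcases Finset.mem_insert.1 hi with rfl | hi
    · exact Nat.zero_le _
    · rw [hl]; exact Finset.le_sup (f := id) hi
  have hlt : ∀ i ∈ insert 0 S, i < m := by
    intro i hi
    rcases Finset.mem_insert.1 hi with rfl | hi
    · exact hm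
    · exact hS i hi
  have hlm := hlt l hlS
  have hmS : m ∉ S := fun h => (hS m h).false
  have hsub : ∀ i ∈ insert 0 S, i ∈ insert 0 (insert m S) := by
    intro i hi
    simp only [Finset.mem_insert] at hi ⊢
    tauto
  have hm' : m ∈ insert 0 (insert m S) := by simp
  rw [← hl, numWords, ← Nat.card_prod]
  refine Nat.card_congr
    { toFun := fun w => (⟨Function.update w.1 m [], ?_, ?_⟩,
        ⟨(w.1 m).drop (w.1 l).length, ?_⟩)
      invFun := fun x => ⟨Function.update x.1.1 m (x.1.1 l ++ x.2.1), ?_, ?_⟩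
      left_inv := ?_
      right_inv := ?_ }
  · intro s hs
    by_cases h : s = m
    · rw [h, Function.update_self]
    · rw [Function.update_of_ne h]
      exact w.2.1 s (by simp [h, hs])
  · intro i hi j hj hij
    rw [Function.update_of_ne (hlt i hi).ne, Function.update_of_ne (hlt j hj).ne]
    exact w.2.2 i (hsub i hi) j (hsub j hj) hij
  · have := (w.2.2 l (hsub l hlS) m hm' hlm.le).2
    rw [List.length_drop]
    omega
  · intro s hs
    simp only [Finset.mem_insert, not_or] at hs
    rw [Function.update_of_ne hs.1]
    exact x.1.2.1 s hs.2
  · intro i hi j hj hij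
    have hcase : ∀ i ∈ insert 0 (insert m S), i = m ∨ i ∈ insert 0 S := by
      intro i hi
      simp only [Finset.mem_insert] at hi ⊢
      tauto
    rcases hcase i hi with hi | hi <;> rcases hcase j hj with hj | hj
    · rw [hi, hj]
      exact ⟨List.prefix_rfl, le_rfl⟩
    · have := hlt j hj
      omega
    · rw [hj, Function.update_of_ne (hlt i hi).ne, Function.update_self]
      have h1 := x.1.2.2 i hi l hlS (hSl i hi)
      refine ⟨h1.1.trans (List.prefix_append _ _), ?_⟩
      have := x.2.2
      rw [List.length_append]
      omega
    · rw [Function.update_of_ne (hlt i hi).ne, Function.update_of_ne (hlt j hj).ne]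
      exact x.1.2.2 i hi j hj hij
  · rintro ⟨w, hw⟩
    apply Subtype.ext
    obtain ⟨v, hv⟩ := (hw.2 l (hsub l hlS) m hm' hlm.le).1
    funext s
    by_cases h : s = m
    · subst h
      simp only [Function.update_self, Function.update_of_ne hlm.ne, ← hv, List.drop_left]
    · simp only [Function.update_of_ne h]
  · rintro ⟨⟨w, hw⟩, ⟨u, hu⟩⟩
    refine Prod.ext (Subtype.ext (funext fun s => ?_)) (Subtype.ext ?_)
    · by_cases h : s = m
      · subst h
        simp only [Function.update_self, hw.1 _ hmS]
      · simp only [Function.update_of_ne h]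
    · simp only [Function.update_self, Function.update_of_ne hlm.ne, List.drop_left]

lemma two_mul_card_le_of_stable {m : ℕ} {S : Finset ℕ} (hS : S ⊆ Finset.Icc 1 m)
    (hst : ∀ i ∈ S, i + 1 ∉ S) : 2 * S.card ≤ m + 1 := by
  have hdisj : Disjoint S (S.map (addRightEmbedding 1)) := by
    rw [Finset.disjoint_left]
    intro i hi hi'
    obtain ⟨j, hj, rfl⟩ := Finset.mem_map.1 hi'
    exact hst j hj hi
  have hsub : S ∪ S.map (addRightEmbedding 1) ⊆ Finset.Icc 1 (m + 1) := by
    intro i hi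
    rcases Finset.mem_union.1 hi with h | h
    · have := Finset.mem_Icc.1 (hS h)
      exact Finset.mem_Icc.2 (by omega)
    · obtain ⟨j, hj, rfl⟩ := Finset.mem_map.1 h
      have := Finset.mem_Icc.1 (hS hj)
      exact Finset.mem_Icc.2 (by simp only [addRightEmbedding_apply]; omega)
  have := Finset.card_le_card hsub
  rw [Finset.card_union_of_disjoint hdisj, Finset.card_map, Nat.card_Icc] at this
  omega

/-- The signed weighted count of the stable subsets of `[n - 1]` disjoint from `T`. -/
def stableSum (t : ℤ) (T : Finset ℕ) (n : ℕ) : ℤ :=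
  ∑ S ∈ (Finset.Icc 1 (n - 1)).powerset,
    if (∀ i ∈ S, i + 1 ∉ S) ∧ Disjoint S T then (-t) ^ S.card * (1 + t) ^ (n - 2 * S.card) else 0

lemma stableSum_zero (t : ℤ) (T : Finset ℕ) : stableSum t T 0 = 1 := by
  simp [stableSum]

lemma stableSum_one (t : ℤ) (T : Finset ℕ) : stableSum t T 1 = 1 + t := by
  simp [stableSum]

lemma stableSum_add_two (t : ℤ) (T : Finset ℕ) (n : ℕ) :
    stableSum t T (n + 2) = (1 + t) * stableSum t T (n + 1) -
      if n + 1 ∈ T then 0 else t * stableSum t T n := by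
  have hIcc : Finset.Icc 1 (n + 1) = insert (n + 1) (Finset.Icc 1 n) := by
    ext i; simp only [Finset.mem_Icc, Finset.mem_insert]; omega
  have hn : n + 1 ∉ Finset.Icc 1 n := by simp
  rw [stableSum, show n + 2 - 1 = n + 1 from rfl, hIcc, Finset.sum_powerset_insert hn,
    sub_eq_add_neg]
  congr 1
  · rw [stableSum, Nat.add_sub_cancel, Finset.mul_sum]
    refine Finset.sum_congr rfl fun S hS => ?_
    split_ifs with h
    · have := two_mul_card_le_of_stable (Finset.mem_powerset.1 hS) h.1
      rw [show n + 2 - 2 * S.card = (n + 1 - 2 * S.card) + 1 by omega]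
      ring
    · simp
  · have hstep : ∀ S ∈ (Finset.Icc 1 n).powerset,
        (if (∀ i ∈ insert (n + 1) S, i + 1 ∉ insert (n + 1) S) ∧ Disjoint (insert (n + 1) S) T
          then (-t) ^ (insert (n + 1) S).card * (1 + t) ^ (n + 2 - 2 * (insert (n + 1) S).card)
          else 0) =
        if n ∉ S then
          (if n + 1 ∈ T then 0 else -t) * (if (∀ i ∈ S, i + 1 ∉ S) ∧ Disjoint S T then
            (-t) ^ S.card * (1 + t) ^ (n - 2 * S.card) else 0)
        else 0 := by
      intro S hS
      have hS' : ∀ i ∈ S, 1 ≤ i ∧ i ≤ n := fun i hi =>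
        Finset.mem_Icc.1 (Finset.mem_powerset.1 hS hi)
      have hnS : n + 1 ∉ S := fun h => by have := hS' _ h; omega
      have hstab : (∀ i ∈ insert (n + 1) S, i + 1 ∉ insert (n + 1) S) ↔
          n ∉ S ∧ ∀ i ∈ S, i + 1 ∉ S := by
        constructor
        · intro h
          refine ⟨fun hn => h n (Finset.mem_insert_of_mem hn) (Finset.mem_insert_self _ _),
            fun i hi hi' => h i (Finset.mem_insert_of_mem hi) (Finset.mem_insert_of_mem hi')⟩
        · rintro ⟨h, h'⟩ i hi hi'
          rcases Finset.mem_insert.1 hi with rfl | hi <;>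
            rcases Finset.mem_insert.1 hi' with hi' | hi'
          · omega
          · have := hS' _ hi'; omega
          · exact h (by rwa [show n = i by omega])
          · exact h' i hi hi'
      simp only [hstab, Finset.disjoint_insert_left]
      rw [Finset.card_insert_of_notMem hnS,
        show n + 2 - 2 * (S.card + 1) = n - 2 * S.card by omega]
      split_ifs <;> first | ring1 | (exfalso; tauto)
    rw [Finset.sum_congr rfl hstep]
    have hrest : ∀ f : Finset ℕ → ℤ, ∑ S ∈ (Finset.Icc 1 n).powerset,
        (if n ∉ S then f S else 0) = ∑ S ∈ (Finset.Icc 1 (n - 1)).powerset, f S := by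
      intro f
      rw [← Finset.sum_filter]
      refine Finset.sum_congr ?_ fun _ _ => rfl
      ext S
      simp only [Finset.mem_filter, Finset.mem_powerset]
      constructor
      · rintro ⟨h, h'⟩ i hi
        have h1 := Finset.mem_Icc.1 (h hi)
        have h2 : i ≠ n := fun h => h' (h ▸ hi)
        exact Finset.mem_Icc.2 (by omega)
      · intro h
        refine ⟨fun i hi => ?_, fun hi => ?_⟩
        · have := Finset.mem_Icc.1 (h hi)
          exact Finset.mem_Icc.2 (by omega)
        · have := Finset.mem_Icc.1 (h hi)
          omega
    rw [hrest, ← Finset.mul_sum, stableSum]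
    split_ifs <;> ring

lemma inter_Icc_succ (T : Finset ℕ) (k : ℕ) :
    T ∩ Finset.Icc 1 (k + 1) =
      if k + 1 ∈ T then insert (k + 1) (T ∩ Finset.Icc 1 k) else T ∩ Finset.Icc 1 k := by
  split_ifs with h
  · ext i
    simp only [Finset.mem_inter, Finset.mem_Icc, Finset.mem_insert]
    constructor
    · rintro ⟨h1, h2⟩
      by_cases hi : i = k + 1
      · exact Or.inl hi
      · exact Or.inr ⟨h1, by omega⟩
    · rintro (rfl | ⟨h1, h2⟩)
      · exact ⟨h, by omega⟩
      · exact ⟨h1, by omega⟩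
  · ext i
    simp only [Finset.mem_inter, Finset.mem_Icc]
    constructor
    · rintro ⟨h1, h2⟩
      have : i ≠ k + 1 := fun h' => h (h' ▸ h1)
      exact ⟨h1, by omega⟩
    · rintro ⟨h1, h2⟩
      exact ⟨h1, by omega⟩

lemma sup_inter_Icc_le (T : Finset ℕ) (k : ℕ) : (T ∩ Finset.Icc 1 k).sup id ≤ k :=
  Finset.sup_le fun _ hi => (Finset.mem_Icc.1 (Finset.mem_inter.1 hi).2).2

lemma sup_inter_Icc_of_mem {T : Finset ℕ} {k : ℕ} (hk : 1 ≤ k) (hkT : k ∈ T) :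
    (T ∩ Finset.Icc 1 k).sup id = k :=
  le_antisymm (sup_inter_Icc_le T k)
    (Finset.le_sup (f := id) (Finset.mem_inter.2 ⟨hkT, Finset.mem_Icc.2 ⟨hk, le_rfl⟩⟩))

lemma card_wordChains_inter_Icc_succ (t : ℕ) {T : Finset ℕ} {k : ℕ} (h : k + 1 ∈ T) :
    Nat.card (wordChains t (T ∩ Finset.Icc 1 (k + 1))) =
      Nat.card (wordChains t (T ∩ Finset.Icc 1 k)) *
        numWords t (k + 1 - (T ∩ Finset.Icc 1 k).sup id) := by
  rw [inter_Icc_succ, if_pos h]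
  refine card_wordChains_insert t (Nat.succ_pos k) (by simp) fun s hs => ?_
  have := (Finset.mem_Icc.1 (Finset.mem_inter.1 hs).2).2
  omega

lemma stableSum_eq (t : ℕ) (T : Finset ℕ) (k : ℕ) :
    stableSum t T k = Nat.card (wordChains t (T ∩ Finset.Icc 1 k)) *
        numWords t (k - (T ∩ Finset.Icc 1 k).sup id) ∧
    stableSum t T (k + 1) = Nat.card (wordChains t (T ∩ Finset.Icc 1 k)) *
        numWords t (k + 1 - (T ∩ Finset.Icc 1 k).sup id) := by
  induction k with
  | zero =>
    have h : T ∩ Finset.Icc 1 0 = ∅ := by simp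
    rw [h, card_wordChains_empty, stableSum_zero, stableSum_one, Finset.sup_empty, Nat.bot_eq_zero,
      Nat.sub_zero, Nat.sub_zero, numWords_succ, numWords_zero]
    simp
  | succ k ih =>
    obtain ⟨ih1, ih2⟩ := ih
    have hle := sup_inter_Icc_le T k
    by_cases h : k + 1 ∈ T
    · have hsup := sup_inter_Icc_of_mem (Nat.succ_pos k) h
      rw [stableSum_add_two, if_pos h, card_wordChains_inter_Icc_succ t h, hsup, Nat.sub_self,
        show k + 1 + 1 - (k + 1) = 0 + 1 by omega, numWords_succ, numWords_zero, ih2]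
      push_cast
      constructor <;> ring
    · rw [stableSum_add_two, if_neg h, inter_Icc_succ, if_neg h]
      refine ⟨ih2, ?_⟩
      rw [ih2, ih1, show k + 1 + 1 - (T ∩ Finset.Icc 1 k).sup id =
          k - (T ∩ Finset.Icc 1 k).sup id + 1 + 1 by omega,
        show k + 1 - (T ∩ Finset.Icc 1 k).sup id = k - (T ∩ Finset.Icc 1 k).sup id + 1 by omega,
        numWords_succ t (_ + 1), numWords_succ]
      push_cast
      ring

lemma card_wordChains_eq_stableSum (t n : ℕ) {T : Finset ℕ} (hT : T ⊆ Finset.Icc 1 (n + 1)) :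
    (Nat.card (wordChains t T) : ℤ) =
      stableSum t T (n + 1) - if n + 1 ∈ T then 0 else t * stableSum t T n := by
  have hT' : T ∩ Finset.Icc 1 (n + 1) = T := Finset.inter_eq_left.2 hT
  by_cases h : n + 1 ∈ T
  · rw [if_pos h, (stableSum_eq t T (n + 1)).1, sup_inter_Icc_of_mem (Nat.succ_pos n) h,
      Nat.sub_self, numWords_zero, hT']
    simp
  · have hTn : T ∩ Finset.Icc 1 n = T := by rwa [inter_Icc_succ, if_neg h] at hT'
    have hle := sup_inter_Icc_le T n
    rw [if_neg h, (stableSum_eq t T n).1, (stableSum_eq t T n).2,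
      show n + 1 - (T ∩ Finset.Icc 1 n).sup id = n - (T ∩ Finset.Icc 1 n).sup id + 1 by omega,
      numWords_succ, hTn]
    push_cast
    ring

/-- Interchanging the sums over stable sets `S` and over subsets `T` of their complements. -/
lemma sum_stable_sum_powerset_sdiff (t : ℤ) (n : ℕ) (f : Finset ℕ → ℤ) :
    ∑ S ∈ (Finset.Icc 1 (n - 1)).powerset.filter (fun S => ∀ i ∈ S, i + 1 ∉ S),
      (∑ T ∈ (Finset.Icc 1 n \ S).powerset,
        (-1 : ℤ) ^ ((Finset.Icc 1 n \ S) \ T).card * f T) *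
          t ^ S.card * (1 + t) ^ (n - 2 * S.card) =
    ∑ T ∈ (Finset.Icc 1 n).powerset,
      (-1 : ℤ) ^ (Finset.Icc 1 n \ T).card * f T * stableSum t T n := by
  simp only [stableSum, Finset.mul_sum]
  rw [Finset.sum_comm, Finset.sum_filter]
  refine Finset.sum_congr rfl fun S hS => ?_
  have hSn : S ⊆ Finset.Icc 1 n :=
    (Finset.mem_powerset.1 hS).trans (Finset.Icc_subset_Icc_right (Nat.sub_le n 1))
  split_ifs with hst
  · have hpow : (Finset.Icc 1 n \ S).powerset =
        (Finset.Icc 1 n).powerset.filter (fun T => Disjoint S T) := by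
      ext T
      simp only [Finset.mem_powerset, Finset.mem_filter, Finset.subset_sdiff, disjoint_comm]
    rw [hpow, Finset.sum_filter, Finset.sum_mul, Finset.sum_mul]
    refine Finset.sum_congr rfl fun T hT => ?_
    by_cases hd : Disjoint S T
    · have hcard : (Finset.Icc 1 n \ T).card = ((Finset.Icc 1 n \ S) \ T).card + S.card := by
        have : S ⊆ Finset.Icc 1 n \ T := Finset.subset_sdiff.2 ⟨hSn, hd⟩
        rw [sdiff_right_comm, Finset.card_sdiff_add_card_eq_card this]
      rw [if_pos hd, if_pos ⟨hst, hd⟩, hcard, pow_add, neg_pow t]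
      have : ((-1 : ℤ) ^ S.card) * (-1) ^ S.card = 1 := by
        rw [← mul_pow]; simp
      linear_combination -((-1 : ℤ) ^ ((Finset.Icc 1 n \ S) \ T).card * f T * t ^ S.card *
        (1 + t) ^ (n - 2 * S.card)) * this
    · rw [if_neg hd, if_neg fun h => hd h.2]
      ring
  · symm
    refine Finset.sum_eq_zero fun T _ => ?_
    rw [if_neg fun h => hst h.1, mul_zero]

theorem betaQ_eq_gamma_sum (n t : ℕ) (hn : 1 ≤ n) (ht : 1 ≤ t)
    (P : Type) [Fintype P] [PartialOrder P] [BoundedOrder P] (rk : P → ℕ)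
    (hrk_bot : rk ⊥ = 0) (hrk_top : rk ⊤ = n + 1)
    (hgraded : ∀ x y : P, x ⋖ y → rk y = rk x + 1)
    (G : Type) [Group G] [Fintype G] [MulAction G P]
    (hact : ∀ (g : G) (x y : P), x ≤ y → g • x ≤ g • y) (g : G) :
    betaQ P G rk t n (Finset.Icc 1 n) g =
      (∑ S ∈ (Finset.Icc 1 (n - 1)).powerset.filter (fun S => ∀ i ∈ S, i + 1 ∉ S),
        betaP P G rk (Finset.Icc 1 n \ S) g *
          (t : ℤ) ^ S.card * (1 + (t : ℤ)) ^ (n - 2 * S.card)) +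
      (∑ S ∈ (Finset.Icc 1 (n - 2)).powerset.filter (fun S => ∀ i ∈ S, i + 1 ∉ S),
        betaP P G rk (Finset.Icc 1 (n - 1) \ S) g *
          (t : ℤ) ^ (S.card + 1) * (1 + (t : ℤ)) ^ (n - 1 - 2 * S.card)) := by
  obtain ⟨m, rfl⟩ : ∃ m, n = m + 1 := ⟨n - 1, by omega⟩
  have hIcc : Finset.Icc 1 (m + 1) = insert (m + 1) (Finset.Icc 1 m) := by
    ext i; simp only [Finset.mem_Icc, Finset.mem_insert]; omega
  have hm : m + 1 ∉ Finset.Icc 1 m := by simp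
  have hfirst := sum_stable_sum_powerset_sdiff t (m + 1) (fun T => (alphaP P G rk T g : ℤ))
  have hsecond : (∑ S ∈ (Finset.Icc 1 (m + 1 - 2)).powerset.filter (fun S => ∀ i ∈ S, i + 1 ∉ S),
      betaP P G rk (Finset.Icc 1 (m + 1 - 1) \ S) g *
        (t : ℤ) ^ (S.card + 1) * (1 + (t : ℤ)) ^ (m + 1 - 1 - 2 * S.card)) =
      ∑ T ∈ (Finset.Icc 1 (m + 1)).powerset, (-1 : ℤ) ^ (Finset.Icc 1 (m + 1) \ T).card *
        (alphaP P G rk T g : ℤ) * -(if m + 1 ∈ T then 0 else t * stableSum t T m) := by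
    rw [hIcc, Finset.sum_powerset_insert hm,
      Finset.sum_eq_zero (s := (Finset.Icc 1 m).powerset)
        (f := fun T => _ * (alphaP P G rk (insert (m + 1) T) g : ℤ) * _)
        (fun T _ => by rw [if_pos (Finset.mem_insert_self _ _), neg_zero, mul_zero]), add_zero]
    have h := congrArg ((t : ℤ) * ·)
      (sum_stable_sum_powerset_sdiff t m (fun T => (alphaP P G rk T g : ℤ)))
    rw [Finset.mul_sum, Finset.mul_sum] at h
    refine Eq.trans (Finset.sum_congr rfl fun S _ => ?_)
      (h.trans (Finset.sum_congr rfl fun T hT => ?_))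
    · rw [Nat.add_sub_cancel, pow_succ, betaP]
      ring
    · have hmT : m + 1 ∉ T := fun h => hm (Finset.mem_powerset.1 hT h)
      rw [if_neg hmT, Finset.insert_sdiff_of_notMem _ hmT,
        Finset.card_insert_of_notMem (fun h => hm (Finset.mem_sdiff.1 h).1)]
      ring
  rw [hsecond]
  simp only [betaP, betaQ]
  rw [hfirst, ← Finset.sum_add_distrib]
  refine Finset.sum_congr rfl fun T hT => ?_
  have hT' := Finset.mem_powerset.1 hT
  rw [alphaQ_eq_alphaP_mul_card_wordChains hrk_bot hrk_top hgraded hact g T hT', Nat.cast_mul,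
    card_wordChains_eq_stableSum t m hT']
  ring

end
end

section
/- For every n ≥ 1, the polynomial χ_t(n) := Σ (−1)^{n−k} [a₁+1]_t [a₂+1]_t ⋯ [a_k+1]_t, where the sum ranges over all compositions (a₁, a₂, ..., a_k) of n (sequences of positive integers with a₁ + ⋯ + a_k = n), equals 1+t if n = 1, equals t if n = 2, and equals 0 for all n ≥ 3. -/
/-!
STATEMENT 6: For every n ≥ 1, χ_t(n) := Σ_{(a₁,…,a_k) ⊨ n} (−1)^{n−k} [a₁+1]_t ⋯ [a_k+1]_t,
summed over all compositions of n, equals 1+t if n = 1, t if n = 2, and 0 for all n ≥ 3.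
-/

noncomputable section

/-- `[m]_t = 1 + t + ⋯ + t^{m-1}` as a polynomial in the indeterminate `t` over `ℤ`. -/
def qt (m : ℕ) : Polynomial ℤ := ∑ i ∈ Finset.range m, Polynomial.X ^ i

/-- The composition of `n + 1` with first block `i + 1` followed by the blocks of `p.2`. -/
def consComposition {n : ℕ} (p : Σ i : Fin (n + 1), Composition (n - i)) :
    Composition (n + 1) where
  blocks := (p.1 + 1) :: p.2.blocks
  blocks_pos := by
    intro j hj
    rcases List.mem_cons.1 hj with rfl | hj
    · omega
    · exact p.2.blocks_pos hj
  blocks_sum := by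
    have := p.1.is_lt
    rw [List.sum_cons, p.2.blocks_sum]
    omega

theorem consComposition_bijective (n : ℕ) : Function.Bijective (consComposition (n := n)) := by
  constructor
  · rintro ⟨i, c⟩ ⟨j, d⟩ h
    have hb : (i.val + 1) :: c.blocks = (j.val + 1) :: d.blocks := congrArg Composition.blocks h
    obtain ⟨hij, hcd⟩ := List.cons.inj hb
    obtain rfl : i = j := Fin.ext (by omega)
    obtain rfl : c = d := Composition.ext hcd
    rfl
  · rintro ⟨_ | ⟨a, l⟩, hpos, hsum⟩
    · simp at hsum
    · have ha : 0 < a := hpos List.mem_cons_self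
      rw [List.sum_cons] at hsum
      refine ⟨⟨⟨a - 1, by omega⟩, ⟨l, fun h => hpos (List.mem_cons_of_mem _ h), ?_⟩⟩, ?_⟩
      · change l.sum = n - (a - 1)
        omega
      · ext1
        change (a - 1 + 1) :: l = a :: l
        rw [Nat.sub_add_cancel ha]

/-- The sum over compositions of `n` of the products of the weights `g a` of the blocks `a`. -/
def compositionSum {R : Type*} [CommSemiring R] (g : ℕ → R) (n : ℕ) : R :=
  ∑ c : Composition n, (c.blocks.map g).prod

theorem compositionSum_zero {R : Type*} [CommSemiring R] (g : ℕ → R) :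
    compositionSum g 0 = 1 := by
  have h (c : Composition 0) : (c.blocks.map g).prod = 1 := by
    rw [c.blocks_eq_nil.2 rfl, List.map_nil, List.prod_nil]
  simp [compositionSum, h, composition_card]

theorem compositionSum_succ {R : Type*} [CommSemiring R] (g : ℕ → R) (n : ℕ) :
    compositionSum g (n + 1) =
      ∑ i ∈ Finset.range (n + 1), g (i + 1) * compositionSum g (n - i) := by
  rw [Finset.sum_range fun i => g (i + 1) * compositionSum g (n - i)]
  unfold compositionSum
  rw [← Function.Bijective.sum_comp (consComposition_bijective n), Fintype.sum_sigma]
  simp [consComposition, Finset.mul_sum]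

theorem neg_one_pow_mul_prod_map {R : Type*} [CommRing R] (f : ℕ → R) (l : List ℕ)
    (hl : ∀ a ∈ l, 0 < a) :
    (-1) ^ (l.sum - l.length) * (l.map f).prod =
      (l.map fun a => (-1) ^ (a - 1) * f a).prod := by
  induction l with
  | nil => simp
  | cons a l ih =>
    have hpos : ∀ b ∈ l, 0 < b := fun b hb => hl b (List.mem_cons_of_mem _ hb)
    have ha : 0 < a := hl a List.mem_cons_self
    have hle : l.length ≤ l.sum := List.length_le_sum_of_one_le l hpos
    have hexp : a + l.sum - (l.length + 1) = (a - 1) + (l.sum - l.length) := by omega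
    simp only [List.map_cons, List.prod_cons, List.sum_cons, List.length_cons]
    rw [← ih hpos, hexp, pow_add]
    ring

theorem qt_succ (m : ℕ) : qt (m + 1) = qt m + Polynomial.X ^ m :=
  Finset.sum_range_succ _ _

theorem compositionSum_qt_one :
    compositionSum (fun a => (-1) ^ (a - 1) * qt (a + 1)) 1 = 1 + Polynomial.X := by
  rw [compositionSum_succ]
  simp [compositionSum_zero, qt, Finset.sum_range_succ]

theorem compositionSum_qt_two :
    compositionSum (fun a => (-1) ^ (a - 1) * qt (a + 1)) 2 = Polynomial.X := by
  rw [compositionSum_succ, Finset.sum_range_succ, Finset.sum_range_one, Nat.sub_zero,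
    Nat.sub_self, compositionSum_zero, compositionSum_qt_one]
  simp [qt, Finset.sum_range_succ]
  ring

theorem compositionSum_qt_add_three (n : ℕ) :
    compositionSum (fun a => (-1) ^ (a - 1) * qt (a + 1)) (n + 3) = 0 := by
  induction n using Nat.strong_induction_on with
  | _ n ih =>
    rw [compositionSum_succ, Finset.sum_range_succ, Finset.sum_range_succ,
      Finset.sum_range_succ, Finset.sum_eq_zero]
    · have h₂ : n + 2 - n = 2 := by omega
      have h₁ : n + 2 - (n + 1) = 1 := by omega
      rw [h₂, h₁, Nat.sub_self, compositionSum_zero, compositionSum_qt_one,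
        compositionSum_qt_two]
      simp only [Nat.add_sub_cancel, qt_succ, pow_succ]
      ring
    · intro i hi
      have hi := Finset.mem_range.1 hi
      have h : n + 2 - i = (n - i - 1) + 3 := by omega
      rw [h, ih _ (by omega), mul_zero]

theorem chi_compositions (n : ℕ) (hn : 1 ≤ n) :
    ∑ c : Composition n,
        (-1 : Polynomial ℤ) ^ (n - c.length) * (c.blocks.map (fun a => qt (a + 1))).prod =
      if n = 1 then 1 + Polynomial.X else if n = 2 then Polynomial.X else 0 := by
  have h : ∑ c : Composition n,
        (-1 : Polynomial ℤ) ^ (n - c.length) * (c.blocks.map (fun a => qt (a + 1))).prod =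
      compositionSum (fun a => (-1) ^ (a - 1) * qt (a + 1)) n := by
    refine Finset.sum_congr rfl fun c _ => ?_
    rw [← neg_one_pow_mul_prod_map _ _ fun a ha => c.blocks_pos ha, c.blocks_sum,
      c.blocks_length]
  rw [h]
  match n, hn with
  | 1, _ => simpa using compositionSum_qt_one
  | 2, _ => simpa using compositionSum_qt_two
  | n + 3, _ => simpa using compositionSum_qt_add_three n

end
end

section
/- Let t and n be positive integers and let S = {s₁ < s₂ < ⋯ < s_k} ⊆ [n]. Then the number of multichains τ₁ ⪯ τ₂ ⪯ ⋯ ⪯ τ_k in the poset T_{t,n} satisfying ρ(τ₁) ≤ s₁ and ρ(τ_j) − ρ(τ_{j−1}) ≤ s_j − s_{j−1} for 2 ≤ j ≤ k equals φ_t(S) = [s₁+1]_t [s₂−s₁+1]_t ⋯ [s_k−s_{k−1}+1]_t, evaluated at the integer t. -/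
/-!
STATEMENT 8: Let t, n be positive integers and S = {s₁ < ⋯ < s_k} ⊆ [n]. The number of
multichains τ₁ ⪯ ⋯ ⪯ τ_k in T_{t,n} with ρ(τ₁) ≤ s₁ and ρ(τ_j) − ρ(τ_{j−1}) ≤ s_j − s_{j−1}
for 2 ≤ j ≤ k equals φ_t(S) = [s₁+1]_t [s₂−s₁+1]_t ⋯ [s_k−s_{k−1}+1]_t evaluated at t.

T_{t,n} is modelled as words of length ≤ n over a t-letter alphabet under the prefix order,
the rank ρ being the length.  The difference condition is stated additively
(ρ(τ_j) + s_{j−1} ≤ ρ(τ_{j−1}) + s_j), which is equivalent for a multichain.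
-/

noncomputable section

/-- Helper: given the previous element `prev` and the (sorted, increasing) list of remaining
elements `s₁ < s₂ < ⋯`, returns `[s₁ - prev + 1]_t [s₂ - s₁ + 1]_t ⋯`. -/
def phiAux : ℕ → List ℕ → Polynomial ℤ
  | _, [] => 1
  | prev, s :: rest => qt (s - prev + 1) * phiAux s rest

/-- `φ_t(S) = [s₁+1]_t [s₂−s₁+1]_t ⋯ [s_k−s_{k−1}+1]_t` for `S = {s₁ < s₂ < ⋯ < s_k}`,
with `φ_t(∅) = 1`. -/
def phi (S : Finset ℕ) : Polynomial ℤ := phiAux 0 (S.sort (· ≤ ·))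

/-- `τ` is a multichain of words above `w` (for the prefix order) whose consecutive length
increments are bounded by the consecutive increments of `p :: L`. -/
def IsBoundedChain {α : Type*} (w : List α) (p : ℕ) (L : List ℕ) {k : ℕ}
    (τ : Fin k → List α) : Prop :=
  (∀ h : 0 < k, w <+: τ ⟨0, h⟩ ∧ (τ ⟨0, h⟩).length + p ≤ w.length + L.getD 0 0) ∧
    ∀ i : ℕ, ∀ h : i + 1 < k, τ ⟨i, Nat.lt_of_succ_lt h⟩ <+: τ ⟨i + 1, h⟩ ∧
      (τ ⟨i + 1, h⟩).length + L.getD i 0 ≤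
        (τ ⟨i, Nat.lt_of_succ_lt h⟩).length + L.getD (i + 1) 0

theorem isBoundedChain_cons {α : Type*} (w : List α) (p s : ℕ) (L : List ℕ) {k : ℕ}
    (u : List α) (τ : Fin k → List α) :
    IsBoundedChain w p (s :: L) (Fin.cons u τ : Fin (k + 1) → List α) ↔
      (w <+: u ∧ u.length + p ≤ w.length + s) ∧ IsBoundedChain u s L τ := by
  constructor
  · rintro ⟨h0, h1⟩
    refine ⟨h0 k.succ_pos, fun h => h1 0 (Nat.succ_lt_succ h), fun i h => ?_⟩
    exact h1 (i + 1) (Nat.succ_lt_succ h)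
  · rintro ⟨h0, h1, h2⟩
    refine ⟨fun _ => h0, fun i h => ?_⟩
    cases i with
    | zero => exact h1 (Nat.lt_of_succ_lt_succ h)
    | succ i => exact h2 i (Nat.lt_of_succ_lt_succ h)

/-- A bounded chain is its first word together with a bounded chain above that word. -/
def boundedChainConsEquiv {α : Type*} (w : List α) (p s : ℕ) (L : List ℕ) (k : ℕ) :
    {τ : Fin (k + 1) → List α // IsBoundedChain w p (s :: L) τ} ≃
      Σ u : {u : List α // w <+: u ∧ u.length + p ≤ w.length + s},
        {τ : Fin k → List α // IsBoundedChain u.1 s L τ} where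
  toFun τ :=
    have h := (isBoundedChain_cons w p s L (τ.1 0) (Fin.tail τ.1)).1
      ((Fin.cons_self_tail τ.1).symm ▸ τ.2)
    ⟨⟨τ.1 0, h.1⟩, ⟨Fin.tail τ.1, h.2⟩⟩
  invFun x := ⟨Fin.cons x.1.1 x.2.1, (isBoundedChain_cons w p s L _ _).2 ⟨x.1.2, x.2.2⟩⟩
  left_inv τ := Subtype.ext (Fin.cons_self_tail τ.1)
  right_inv _ := rfl

/-- Words of length at most `m`, sorted by length. -/
def wordsLengthLeEquiv (α : Type*) (m : ℕ) :
    {l : List α // l.length ≤ m} ≃ Σ i : Fin (m + 1), List.Vector α i where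
  toFun l := ⟨⟨l.1.length, Nat.lt_succ_of_le l.2⟩, ⟨l.1, rfl⟩⟩
  invFun x := ⟨x.2.1, x.2.2.trans_le (Nat.le_of_lt_succ x.1.2)⟩
  left_inv _ := rfl
  right_inv := by
    rintro ⟨⟨i, hi⟩, ⟨l, hl⟩⟩
    dsimp only at hl
    subst hl
    rfl

theorem card_words_length_le (α : Type*) [Fintype α] (m : ℕ) :
    Nat.card {l : List α // l.length ≤ m} =
      ∑ i ∈ Finset.range (m + 1), Fintype.card α ^ i := by
  rw [Nat.card_congr (wordsLengthLeEquiv α m), Nat.card_eq_fintype_card, Fintype.card_sigma,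
    Finset.sum_range]
  simp

/-- Extensions of `w` by at most `s - p` letters, identified with the appended words. -/
def extensionEquiv {α : Type*} (w : List α) {p s : ℕ} (h : p ≤ s) :
    {u : List α // w <+: u ∧ u.length + p ≤ w.length + s} ≃
      {l : List α // l.length ≤ s - p} where
  toFun u := ⟨u.1.drop w.length, by
    have := u.2.2
    rw [List.length_drop]
    omega⟩
  invFun l := ⟨w ++ l.1, List.prefix_append _ _, by
    have := l.2
    rw [List.length_append]
    omega⟩
  left_inv := by
    rintro ⟨u, ⟨v, rfl⟩, hu⟩
    simp
  right_inv l := by simp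

theorem eval_qt (m : ℕ) (t : ℤ) : (qt m).eval t = ∑ i ∈ Finset.range m, t ^ i := by
  simp [qt, Polynomial.eval_finsetSum]

theorem finite_extension {α : Type*} [Finite α] (w : List α) (p s : ℕ) :
    Finite {u : List α // w <+: u ∧ u.length + p ≤ w.length + s} :=
  ((List.finite_length_le α (w.length + s)).subset fun _ hu =>
    (Nat.le_add_right _ p).trans hu.2).to_subtype

theorem finite_isBoundedChain {α : Type*} [Finite α] (L : List ℕ) :
    ∀ (w : List α) (p : ℕ), Finite {τ : Fin L.length → List α // IsBoundedChain w p L τ} := by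
  induction L with
  | nil => exact fun w p => inferInstanceAs (Finite {τ : Fin 0 → List α // _})
  | cons s L ih =>
    intro w p
    have := finite_extension w p s
    have (u : {u : List α // w <+: u ∧ u.length + p ≤ w.length + s}) := ih u.1 s
    exact Finite.of_equiv _ (boundedChainConsEquiv w p s L L.length).symm

theorem card_isBoundedChain (α : Type*) [Fintype α] (L : List ℕ) :
    ∀ (w : List α) (p : ℕ), (p :: L).Pairwise (· ≤ ·) →
      (Nat.card {τ : Fin L.length → List α // IsBoundedChain w p L τ} : ℤ) =
        (phiAux p L).eval (Fintype.card α : ℤ) := by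
  induction L with
  | nil =>
    intro w p _
    have : Unique {τ : Fin 0 → List α // IsBoundedChain w p [] τ} :=
      { default := ⟨Fin.elim0, fun h => absurd h (lt_irrefl 0), fun i h => absurd h (by omega)⟩
        uniq := fun _ => Subsingleton.elim _ _ }
    simp [phiAux]
  | cons s L ih =>
    intro w p hp
    obtain ⟨hps, hL⟩ := List.pairwise_cons.1 hp
    have hle : p ≤ s := hps s (by simp)
    have := finite_extension w p s
    have := Fintype.ofFinite {u : List α // w <+: u ∧ u.length + p ≤ w.length + s}
    have (u : {u : List α // w <+: u ∧ u.length + p ≤ w.length + s}) :=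
      finite_isBoundedChain L u.1 s
    rw [List.length_cons, Nat.card_congr (boundedChainConsEquiv w p s L L.length),
      Nat.card_sigma, Nat.cast_sum, Finset.sum_congr rfl fun u _ => ih u.1 s hL,
      Finset.sum_const, Finset.card_univ, ← Nat.card_eq_fintype_card, Nat.card_congr (extensionEquiv w hle),
      card_words_length_le, phiAux, Polynomial.eval_mul, eval_qt, nsmul_eq_mul]
    push_cast
    rfl

theorem IsBoundedChain.prefix_of_le {α : Type*} {w : List α} {p : ℕ} {L : List ℕ} {k : ℕ}
    {τ : Fin k → List α} (h : IsBoundedChain w p L τ) {i j : Fin k} (hij : i ≤ j) :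
    τ i <+: τ j := by
  obtain ⟨i, hi⟩ := i
  obtain ⟨j, hj⟩ := j
  replace hij : i ≤ j := hij
  induction j, hij using Nat.le_induction with
  | base => exact List.prefix_rfl
  | succ j hij ih => exact (ih (Nat.lt_of_succ_lt hj)).trans (h.2 j hj).1

theorem IsBoundedChain.length_le {α : Type*} {L : List ℕ} {k : ℕ}
    {τ : Fin k → List α} (h : IsBoundedChain [] 0 L τ) (i : Fin k) :
    (τ i).length ≤ L.getD i 0 := by
  obtain ⟨i, hi⟩ := i
  induction i with
  | zero => simpa using (h.1 hi).2
  | succ i ih =>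
    have h1 := ih (Nat.lt_of_succ_lt hi)
    have h2 := (h.2 i hi).2
    dsimp only at h1 ⊢
    omega

theorem multichain_count_in_tree (t n : ℕ) (ht : 1 ≤ t) (hn : 1 ≤ n)
    (S : Finset ℕ) (hS : S ⊆ Finset.Icc 1 n) :
    (Nat.card {τ : Fin S.card → {l : List (Fin t) // l.length ≤ n} //
        (∀ i j : Fin S.card, i ≤ j → (τ i).val <+: (τ j).val) ∧
        (∀ h : 0 < S.card, (τ ⟨0, h⟩).val.length ≤ (S.sort (· ≤ ·)).getD 0 0) ∧
        (∀ i : ℕ, ∀ h : i + 1 < S.card,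
          (τ ⟨i + 1, h⟩).val.length + (S.sort (· ≤ ·)).getD i 0 ≤
            (τ ⟨i, Nat.lt_of_succ_lt h⟩).val.length + (S.sort (· ≤ ·)).getD (i + 1) 0)} : ℤ) =
      (phi S).eval (t : ℤ) := by
  have hlen : (S.sort (· ≤ ·)).length = S.card := S.length_sort (· ≤ ·)
  have hmem : ∀ i, i < S.card → (S.sort (· ≤ ·)).getD i 0 ≤ n := fun i hi => by
    rw [List.getD_eq_getElem _ _ (hlen.symm ▸ hi)]
    exact (Finset.mem_Icc.1 (hS ((Finset.mem_sort _).1 (List.getElem_mem _)))).2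
  have hsort : (0 :: S.sort (· ≤ ·)).Pairwise (· ≤ ·) :=
    List.pairwise_cons.2 ⟨fun _ _ => Nat.zero_le _, S.pairwise_sort (· ≤ ·)⟩
  have key := card_isBoundedChain (Fin t) (S.sort (· ≤ ·)) [] 0 hsort
  rw [hlen, Fintype.card_fin] at key
  rw [phi, ← key, Nat.cast_inj]
  refine Nat.card_congr
    { toFun := fun τ => ⟨fun i => (τ.1 i).1, fun h => ⟨List.nil_prefix, ?_⟩, fun i h =>
        ⟨τ.2.1 _ _ (Fin.mk_le_mk.2 i.le_succ), τ.2.2.2 i h⟩⟩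
      invFun := fun τ => ⟨fun i => ⟨τ.1 i, (τ.2.length_le i).trans (hmem i i.2)⟩,
        fun _ _ hij => τ.2.prefix_of_le hij, fun h => τ.2.length_le ⟨0, h⟩,
        fun i h => (τ.2.2 i h).2⟩
      left_inv := fun _ => rfl
      right_inv := fun _ => rfl }
  simpa using τ.2.2.1 h

end
end
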